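/- arXiv:1408.4716 — 2 statements merged into one kernel-verified Lean document; each statement's English description precedes it below -/
import Mathlib

section
/- Let d ≥ 1, k ≥ 2, and let P be a d-dimensional k-template of d-tuples of reals. Then the chromatic number χ(L(ℝ^d,P)) of its template hypergraph equals the least cardinal κ such that κ^{+(e(P)−1)} ≥ 2^{ℵ₀}. -/
open Cardinal

/-- A hypergraph with vertex type `V` is identified with its set of edges
`E : Set (Set V)`.  It is `κ`-colorable if there is a function from `V` to a
set of cardinality at most `κ` that is not constant on any edge. -/
def HGColorable {V : Type} (E : Set (Set V)) (κ : Cardinal) : Prop :=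
  ∃ (α : Type) (φ : V → α), #α ≤ κ ∧ ∀ e ∈ E, ∃ x ∈ e, ∃ y ∈ e, φ x ≠ φ y

/-- The chromatic number of a hypergraph: the least cardinal `κ` such that it
has a proper `κ`-coloring. -/
noncomputable def chrNum {V : Type} (E : Set (Set V)) : Cardinal :=
  sInf {κ | HGColorable E κ}

/-- `cardSucc κ m = κ^{+m}`, the `m`-fold cardinal successor of `κ`. -/
noncomputable def cardSucc (κ : Cardinal) (m : ℕ) : Cardinal := (Order.succ)^[m] κ

/-- `Q` is a homomorphic image of the set `P` of `d`-tuples: there is a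
surjection `f : P → Q` such that `x i = y i` implies `f x i = f y i`. -/
def IsHomImage {d : ℕ} {A : Type} {B : Fin d → Type} (P : Set (Fin d → A))
    (Q : Set (∀ i, B i)) : Prop :=
  ∃ f : (Fin d → A) → (∀ i, B i),
    Set.MapsTo f P Q ∧ Set.SurjOn f P Q ∧
    ∀ x ∈ P, ∀ y ∈ P, ∀ i, x i = y i → f x i = f y i

/-- The edges of the template hypergraph `L(X, P)` where `X = Π i, B i`:
the `k`-element subsets of the vertex set that are homomorphic images of `P`. -/
def templateEdges (k : ℕ) {d : ℕ} {A : Type} {B : Fin d → Type}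
    (P : Set (Fin d → A)) : Set (Set (∀ i, B i)) :=
  {Q | Q.ncard = k ∧ IsHomImage P Q}

/-- `I` is a distinguisher for `P`: any two distinct members of `P` differ at
some coordinate in `I`. -/
def IsDistinguisher {d : ℕ} {A : Type} (P : Set (Fin d → A)) (I : Finset (Fin d)) : Prop :=
  ∀ x ∈ P, ∀ y ∈ P, x ≠ y → ∃ i ∈ I, x i ≠ y i

/-- `eDim P = e(P)`, the least cardinality of a distinguisher for `P`. -/
noncomputable def eDim {d : ℕ} {A : Type} (P : Set (Fin d → A)) : ℕ :=
  sInf {e | ∃ I : Finset (Fin d), IsDistinguisher P I ∧ I.card = e}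

/-- A `d`-dimensional template is simple if for every `m < d` there are
`x, y ∈ P` with `x i = y i` exactly when `i ≠ m`. -/
def IsSimple {d : ℕ} {A : Type} (P : Set (Fin d → A)) : Prop :=
  ∀ m : Fin d, ∃ x ∈ P, ∃ y ∈ P, ∀ i, (x i = y i ↔ i ≠ m)

/-- The edges of the zero hypergraph of a `(k, n)`-ary real polynomial:
`k`-element subsets `{a_0, …, a_{k-1}}` of `ℝⁿ` with `p(a_0, …, a_{k-1}) = 0`
for some ordering of the elements. -/
def zeroEdges {n k : ℕ} (p : MvPolynomial (Fin k × Fin n) ℝ) :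
    Set (Set (Fin n → ℝ)) :=
  {A | ∃ a : Fin k → (Fin n → ℝ), Function.Injective a ∧ A = Set.range a ∧
        MvPolynomial.eval (fun q => a q.1 q.2) p = 0}

/-- `H₂ = (V₂, E₂)` contains (a copy of) `H₁ = (V₁, E₁)`: some injection
`V₁ → V₂` maps every edge of `H₁` onto an edge of `H₂`. -/
def HGContains {V₁ V₂ : Type} (E₁ : Set (Set V₁)) (E₂ : Set (Set V₂)) : Prop :=
  ∃ f : V₁ → V₂, Function.Injective f ∧ ∀ e ∈ E₁, f '' e ∈ E₂

theorem cardSucc_succ (κ : Cardinal) (n : ℕ) :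
    cardSucc κ (n + 1) = Order.succ (cardSucc κ n) :=
  Function.iterate_succ_apply' _ _ _

theorem le_cardSucc (κ : Cardinal) (n : ℕ) : κ ≤ cardSucc κ n := by
  induction n with
  | zero => exact le_rfl
  | succ n ih => exact cardSucc_succ κ n ▸ ih.trans (Order.le_succ _)

theorem cardSucc_lt_aleph0 {κ : Cardinal} (h : κ < ℵ₀) (n : ℕ) : cardSucc κ n < ℵ₀ := by
  induction n with
  | zero => exact h
  | succ n ih => exact cardSucc_succ κ n ▸ isSuccLimit_aleph0.succ_lt ih

/-- If `#X ≤ κ^{+n}` with `κ` infinite, then `X^d` can be partitioned into `κ` classes, each of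
which has a distinguisher with at most `n` elements. -/
theorem exists_coloring_isDistinguisher (d : ℕ) {κ : Cardinal.{0}} (hκ : ℵ₀ ≤ κ) (n : ℕ)
    (X : Type) (hX : #X ≤ cardSucc κ n) :
    ∃ (c : (Fin d → X) → κ.out) (I : κ.out → Finset (Fin d)),
      ∀ a, (I a).card ≤ n ∧ IsDistinguisher (c ⁻¹' {a}) (I a) := by
  induction n generalizing X with
  | zero =>
    have h : #(Fin d → X) ≤ #κ.out := by
      rw [mk_out, ← power_def, mk_fin]
      exact (power_le_power_right hX).trans (power_nat_le hκ)
    obtain ⟨c⟩ := h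
    refine ⟨c, fun _ => ∅, fun a => ⟨by simp, ?_⟩⟩
    rintro x hx y hy hxy
    exact absurd (c.injective (hx.trans hy.symm)) hxy
  | succ n ih =>
    obtain ⟨_, _, hord⟩ := exists_ord_eq_type_lt X
    have hseg (x : X) : #(Set.Iic x) ≤ cardSucc κ n := by
      have hlt : #(Set.Iio x) < #X := mk_Iio_lt x hord
      have hle : #(Set.Iio x) ≤ cardSucc κ n := by
        rw [← Order.lt_succ_iff, ← cardSucc_succ]
        exact hlt.trans_le hX
      rw [← Set.Iio_insert]
      refine (mk_insert_le).trans ?_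
      have h := hκ.trans (le_cardSucc κ n)
      exact (add_le_add hle (one_lt_aleph0.le.trans h)).trans (add_eq_self h).le
    choose c I hI using fun x => ih (Set.Iic x) (hseg x)
    rcases subsingleton_or_nontrivial (Fin d → X) with hsub | ⟨p₀, p₁, hp⟩
    · have : Nonempty κ.out := by
        rw [← mk_ne_zero_iff, mk_out]
        exact (aleph0_pos.trans_le hκ).ne'
      exact ⟨fun _ => Classical.arbitrary _, fun _ => ∅, fun a => ⟨by simp, fun x _ y _ hxy =>
        absurd (Subsingleton.elim x y) hxy⟩⟩
    obtain ⟨i₀, -⟩ := Function.ne_iff.1 hp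
    have : Nonempty (Fin d) := ⟨i₀⟩
    choose j hj using fun p : Fin d → X => Finite.exists_max p
    let β := Fin d × {s : Finset (Fin d) // s.card ≤ n} × κ.out
    have hβ : #β ≤ #κ.out := by
      have h1 : #(Fin d) ≤ κ := (lt_aleph0_of_finite _).le.trans hκ
      have h2 : #{s : Finset (Fin d) // s.card ≤ n} ≤ κ := (lt_aleph0_of_finite _).le.trans hκ
      simp only [β, mk_prod, lift_id, mk_out]
      exact (mul_le_mul' h1 ((mul_le_mul' h2 le_rfl).trans (mul_eq_self hκ).le)).trans
        (mul_eq_self hκ).le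
    obtain ⟨g⟩ := hβ
    let q (p : Fin d → X) : κ.out := c (p (j p)) fun i => ⟨p i, hj p i⟩
    let c' (p : Fin d → X) : β := (j p, ⟨I (p (j p)) (q p), (hI _ _).1⟩, q p)
    have : Nonempty β := ⟨c' p₀⟩
    let J (b : β) : Finset (Fin d) := insert b.1 b.2.1.1
    refine ⟨fun p => g (c' p), fun a => J (Function.invFun g a), fun a => ⟨?_, ?_⟩⟩
    · exact (Finset.card_insert_le _ _).trans (Nat.succ_le_succ (Function.invFun g a).2.1.2)
    · rintro x rfl y hy hxy
      have he : c' y = c' x := g.injective hy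
      simp only [Function.leftInverse_invFun g.injective _]
      simp only [J, c']
      by_cases hne : x (j x) = y (j x)
      · have hj' : j y = j x := congrArg Prod.fst he
        have hq : q y = q x := congrArg (fun b => b.2.2) he
        have hmax : x (j x) = y (j y) := hne.trans (by rw [hj'])
        have hyx (i) : y i ≤ x (j x) := hmax ▸ hj y i
        have hcy : ∀ z (hz : z = y (j y)) (h : ∀ i, y i ≤ z), c z (fun i => ⟨y i, h i⟩) = q y := by
          rintro _ rfl _
          rfl
        obtain ⟨i, hi, hi'⟩ := (hI (x (j x)) (q x)).2 (fun i => ⟨x i, hj x i⟩) rfl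
          (fun i => ⟨y i, hyx i⟩) ((hcy _ hmax hyx).trans hq) (fun h => hxy <| funext fun i =>
            congrArg Subtype.val (congrFun h i))
        exact ⟨i, Finset.mem_insert_of_mem hi, fun h => hi' (Subtype.ext h)⟩
      · exact ⟨j x, Finset.mem_insert_self _ _, hne⟩

/-- If `#X ≥ κ^{+n}` with `κ` infinite, then every `κ`-coloring of `X^n` is constant on a product
of sets with `k` elements. -/
theorem exists_monochromatic_grid (k : ℕ) {κ : Cardinal.{0}} (hκ : ℵ₀ ≤ κ) {α : Type}
    (hα : #α ≤ κ) (n : ℕ) (X : Type) (hX : cardSucc κ n ≤ #X) (c : (Fin n → X) → α) :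
    ∃ (A : Fin n → Finset X) (a : α), (∀ i, (A i).card = k) ∧
      ∀ p, (∀ i, p i ∈ A i) → c p = a := by
  induction n generalizing X with
  | zero => exact ⟨fun _ => ∅, c default, fun i => i.elim0, fun p _ => by
      rw [Subsingleton.elim p default]⟩
  | succ n ih =>
    rw [cardSucc_succ] at hX
    obtain ⟨Y, hY⟩ := le_mk_iff_exists_set.1 ((Order.le_succ _).trans hX)
    have hinf : ℵ₀ ≤ #Y := hY ▸ hκ.trans (le_cardSucc κ n)
    have : Infinite Y := infinite_iff.2 hinf
    choose A a hA hc using fun y : X => ih Y hY.ge fun p => c (Fin.cons y fun i => p i)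
    let β := (Fin n → Finset Y) × α
    have hβ : #β < #X := by
      refine lt_of_le_of_lt ?_ (Order.succ_le_iff.1 hX)
      rw [← hY]
      have h1 : #(Fin n → Finset Y) ≤ #Y := by
        rw [← power_def, mk_fin, mk_finset_of_infinite]
        exact power_nat_le hinf
      have h2 : #α ≤ #Y := hα.trans (hY ▸ le_cardSucc κ n)
      simp only [β, mk_prod, lift_id]
      exact (mul_le_mul' h1 h2).trans (mul_eq_self hinf).le
    have : Infinite X :=
      infinite_iff.2 ((hκ.trans (le_cardSucc κ n)).trans ((Order.le_succ _).trans hX))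
    obtain ⟨⟨B, b⟩, hfib⟩ := exists_infinite_fiber (fun y => ((A y, a y) : β)) hβ
    obtain ⟨S, hS, hSk⟩ := (Set.infinite_coe_iff.1 hfib).exists_subset_card_eq k
    have hSB (y) (hy : y ∈ S) : A y = B ∧ a y = b := by
      have := hS hy
      simp only [Set.mem_preimage, Set.mem_singleton_iff, Prod.mk.injEq] at this
      exact ⟨this.1, this.2⟩
    have hB (i) : (B i).card = k := by
      obtain ⟨y, hy⟩ := hfib.nonempty
      simp only [Set.mem_preimage, Set.mem_singleton_iff, Prod.mk.injEq] at hy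
      exact hy.1 ▸ hA y i
    refine ⟨Fin.cons S fun i => (B i).map (Function.Embedding.subtype _), b, ?_, ?_⟩
    · intro i
      cases i using Fin.cases with
      | zero => simpa using hSk
      | succ i => simpa using hB i
    · intro p hp
      have h0 : p 0 ∈ S := by simpa using hp 0
      have h (i : Fin n) : ∃ h : p i.succ ∈ Y, ⟨p i.succ, h⟩ ∈ B i := by
        simpa using hp i.succ
      choose h h' using h
      obtain ⟨e1, e2⟩ := hSB _ h0
      have := hc (p 0) (fun i => ⟨p i.succ, h i⟩) fun i => by rw [e1]; exact h' i
      rw [← e2, ← this]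
      congr 1
      ext i
      cases i using Fin.cases <;> rfl

section Template

variable {d : ℕ} {P : Set (Fin d → ℝ)}

theorem exists_isDistinguisher_card_eq_eDim {A : Type} (P : Set (Fin d → A)) :
    ∃ I : Finset (Fin d), IsDistinguisher P I ∧ I.card = eDim P :=
  Nat.sInf_mem (s := {e | ∃ I : Finset (Fin d), IsDistinguisher P I ∧ I.card = e})
    ⟨_, Finset.univ, fun _ _ _ _ hxy => by simpa using Function.ne_iff.1 hxy, rfl⟩

theorem eDim_le_card {A : Type} {P : Set (Fin d → A)} {I : Finset (Fin d)}
    (hI : IsDistinguisher P I) : eDim P ≤ I.card :=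
  Nat.sInf_le ⟨I, hI, rfl⟩

theorem eDim_pos {A : Type} {P : Set (Fin d → A)} (hP : P.Nontrivial) : 0 < eDim P := by
  obtain ⟨I, hI, hcard⟩ := exists_isDistinguisher_card_eq_eDim P
  obtain ⟨x, hx, y, hy, hxy⟩ := hP
  obtain ⟨i, hi, -⟩ := hI x hx y hy hxy
  exact hcard ▸ Finset.card_pos.2 ⟨i, hi⟩

/-- A distinguisher for a homomorphic image of the same finite size is a distinguisher. -/
theorem IsDistinguisher.of_isHomImage {A : Type} {B : Type} {P : Set (Fin d → A)}
    {Q : Set (Fin d → B)} (hfin : P.Finite) (hcard : Q.ncard = P.ncard) (h : IsHomImage P Q)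
    {I : Finset (Fin d)} (hI : IsDistinguisher Q I) : IsDistinguisher P I := by
  obtain ⟨f, hmaps, hsurj, hf⟩ := h
  have himage : f '' P = Q := hsurj.image_eq_of_mapsTo hmaps
  have hinj : Set.InjOn f P := (Set.ncard_image_iff hfin).1 (himage ▸ hcard)
  intro x hx y hy hxy
  obtain ⟨i, hi, hne⟩ := hI _ (hmaps hx) _ (hmaps hy) (hinj.ne hx hy hxy)
  exact ⟨i, hi, fun h => hne (hf x hx y hy i h)⟩

/-- An injective map on a template that preserves coordinatewise equality gives an edge. -/
theorem image_mem_templateEdges {k : ℕ} {f : (Fin d → ℝ) → (Fin d → ℝ)} (hP : P.ncard = k)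
    (hinj : Set.InjOn f P) (hf : ∀ x ∈ P, ∀ y ∈ P, ∀ i, x i = y i → f x i = f y i) :
    f '' P ∈ templateEdges k (B := fun _ : Fin d => ℝ) P :=
  ⟨hP ▸ hinj.ncard_image, f, Set.mapsTo_image f P, Set.surjOn_image f P, hf⟩

theorem hgColorable_templateEdges {k : ℕ} (hk : 2 ≤ k) (hP : P.ncard = k) {κ : Cardinal}
    (h : continuum ≤ cardSucc κ (eDim P - 1)) :
    HGColorable (templateEdges k (B := fun _ : Fin d => ℝ) P) κ := by
  have hκ : ℵ₀ ≤ κ := by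
    by_contra! hlt
    exact (h.trans_lt (cardSucc_lt_aleph0 hlt _)).not_ge aleph0_le_continuum
  obtain ⟨c, I, hI⟩ := exists_coloring_isDistinguisher d hκ (eDim P - 1) ℝ (mk_real.trans_le h)
  refine ⟨κ.out, c, (mk_out κ).le, fun Q ⟨hQ, hhom⟩ => ?_⟩
  by_contra! hmono
  have hfin : P.Finite := Set.finite_of_ncard_pos (by omega)
  have hpos : 0 < eDim P := eDim_pos (Set.one_lt_ncard_iff_nontrivial_and_finite.1 (by omega)).1
  obtain ⟨z, hz⟩ : Q.Nonempty := Set.nonempty_of_ncard_ne_zero (by omega)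
  have hQI : IsDistinguisher Q (I (c z)) := fun x hx y hy hxy =>
    (hI (c z)).2 x (hmono x hx z hz) y (hmono y hy z hz) hxy
  have h1 := eDim_le_card (hQI.of_isHomImage hfin (hQ.trans hP.symm) hhom)
  have h2 := (hI (c z)).1
  omega

theorem not_hgColorable_templateEdges_of_lt_aleph0 {k : ℕ} (hk : 2 ≤ k) (hP : P.ncard = k)
    {κ : Cardinal} (hκ : κ < ℵ₀) :
    ¬ HGColorable (templateEdges k (B := fun _ : Fin d => ℝ) P) κ := by
  rintro ⟨α, φ, hα, hφ⟩
  have hfin : P.Finite := Set.finite_of_ncard_pos (by omega)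
  have : Finite α := lt_aleph0_iff_finite.1 (hα.trans_lt hκ)
  obtain ⟨a, ha, b, c, hc⟩ := Combinatorics.exists_mono_homothetic_copy hfin.toFinset φ
  have hinj : Set.InjOn (fun s : Fin d → ℝ => a • s + b) P := by
    intro x _ y _ hxy
    exact smul_right_injective _ ha.ne' (add_right_cancel hxy)
  obtain ⟨-, ⟨x, hx, rfl⟩, -, ⟨y, hy, rfl⟩, hxy⟩ :=
    hφ _ (image_mem_templateEdges hP hinj fun x _ y _ i h => by simp [h])
  exact hxy ((hc x (hfin.mem_toFinset.2 hx)).trans (hc y (hfin.mem_toFinset.2 hy)).symm)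

theorem not_hgColorable_templateEdges_of_aleph0_le {k : ℕ} (hk : 2 ≤ k) (hP : P.ncard = k)
    {κ : Cardinal} (hκ : ℵ₀ ≤ κ) (h : cardSucc κ (eDim P) ≤ continuum) :
    ¬ HGColorable (templateEdges k (B := fun _ : Fin d => ℝ) P) κ := by
  classical
  rintro ⟨α, φ, hα, hφ⟩
  have hfin : P.Finite := Set.finite_of_ncard_pos (by omega)
  obtain ⟨I, hI, hcard⟩ := exists_isDistinguisher_card_eq_eDim P
  let g := I.equivFinOfCardEq hcard
  let ext (p : Fin (eDim P) → ℝ) (i : Fin d) : ℝ := if hi : i ∈ I then p (g ⟨i, hi⟩) else 0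
  obtain ⟨A, a, hA, ha⟩ := exists_monochromatic_grid k hκ hα (eDim P) ℝ
    (h.trans_eq mk_real.symm) (φ ∘ ext)
  have hemb (j : Fin (eDim P)) : ∃ u : ℝ → ℝ,
      (fun x : Fin d → ℝ => x (g.symm j)) '' P ⊆ u ⁻¹' A j ∧
        Set.InjOn u ((fun x : Fin d → ℝ => x (g.symm j)) '' P) := by
    refine (hfin.image _).exists_injOn_of_encard_le ?_
    rw [Set.encard_coe_eq_coe_finsetCard, hA, ← hP, hfin.cast_ncard_eq]
    exact Set.encard_image_le _ _
  choose u hu huinj using hemb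
  let f (x : Fin d → ℝ) : Fin d → ℝ := ext fun j => u j (x (g.symm j))
  have hinj : Set.InjOn f P := by
    intro x hx y hy hxy
    by_contra hne
    obtain ⟨i, hi, hi'⟩ := hI x hx y hy hne
    have := congrFun hxy i
    simp only [f, ext, hi, dif_pos] at this
    refine hi' ?_
    simpa using huinj (g ⟨i, hi⟩) ⟨x, hx, rfl⟩ ⟨y, hy, rfl⟩ this
  have hmono (x) (hx : x ∈ P) : φ (f x) = a := ha _ fun j => hu j ⟨x, hx, rfl⟩
  have hedge := image_mem_templateEdges hP hinj fun x _ y _ i h => by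
    by_cases hi : i ∈ I <;> simp [f, ext, hi, h]
  obtain ⟨-, ⟨x, hx, rfl⟩, -, ⟨y, hy, rfl⟩, hxy⟩ := hφ _ hedge
  exact hxy ((hmono x hx).trans (hmono y hy).symm)

end Template

/-- Theorem 1.1: the chromatic number of the template
hypergraph `L(ℝ^d, P)` is the least cardinal `κ` with `κ^{+(e(P)-1)} ≥ 2^{ℵ₀}`. -/
theorem statement0 (d k : ℕ) (hd : 1 ≤ d) (hk : 2 ≤ k)
    (P : Set (Fin d → ℝ)) (hP : P.ncard = k) :
    chrNum (templateEdges k (B := fun _ : Fin d => ℝ) P) =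
      sInf {κ : Cardinal | Cardinal.continuum ≤ cardSucc κ (eDim P - 1)} := by
  refine congrArg sInf (Set.ext fun κ => ⟨fun h => ?_, hgColorable_templateEdges hk hP⟩)
  by_contra hlt
  rcases lt_or_ge κ ℵ₀ with hκ | hκ
  · exact not_hgColorable_templateEdges_of_lt_aleph0 hk hP hκ h
  · refine not_hgColorable_templateEdges_of_aleph0_le hk hP hκ ?_ h
    have hpos : 0 < eDim P := eDim_pos (Set.one_lt_ncard_iff_nontrivial_and_finite.1 (by omega)).1
    rw [← Nat.sub_add_cancel hpos, cardSucc_succ, Order.succ_le_iff]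
    exact not_le.1 hlt
end

section
/- Let k ≥ 2, let H be an algebraic k-hypergraph on ℝⁿ, and let κ be an infinite cardinal. Then χ(H) ≤ κ if and only if for every d ≥ 1 and every d-dimensional k-template P of d-tuples of reals such that H contains an L(ℝ^d,P), one has χ(L(ℝ^d,P)) ≤ κ. -/
open Cardinal

/-- The algebra of real-analytic functions on a subset `U` of `ι → ℝ`. -/
def analyticAlgebra {ι : Type*} [Fintype ι] (U : Set (ι → ℝ)) : Subalgebra ℝ (U → ℝ) where
  carrier := {g | ∃ G : (ι → ℝ) → ℝ, AnalyticOnNhd ℝ G U ∧ ∀ x : U, G x = g x}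
  mul_mem' := by
    rintro a b ⟨A, hA, ha⟩ ⟨B, hB, hb⟩
    exact ⟨A * B, hA.mul hB, fun x => by simp [ha, hb]⟩
  add_mem' := by
    rintro a b ⟨A, hA, ha⟩ ⟨B, hB, hb⟩
    exact ⟨A + B, hA.add hB, fun x => by simp [ha, hb]⟩
  algebraMap_mem' r := ⟨fun _ => r, analyticOnNhd_const, fun x => rfl⟩

namespace analyticAlgebra

variable {ι : Type*} [Fintype ι] {U : Set (ι → ℝ)}

/-- The restriction of the `i`-th coordinate function. -/
def coord (U : Set (ι → ℝ)) (i : ι) : analyticAlgebra U :=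
  ⟨fun x => x.1 i, fun x => x i,
    (ContinuousLinearMap.proj (R := ℝ) (φ := fun _ : ι => ℝ) i).analyticOnNhd _, fun _ => rfl⟩

/-- Evaluation at a point of `U`. -/
def evalAt (x : U) : analyticAlgebra U →ₐ[ℝ] ℝ :=
  (Pi.evalAlgHom ℝ (fun _ : U => ℝ) x).comp (analyticAlgebra U).val

@[simp] lemma evalAt_apply (x : U) (g : analyticAlgebra U) : evalAt x g = g.1 x := rfl

variable {F : Type*} [Field F] [Algebra F ℝ]

noncomputable instance : Algebra (MvPolynomial ι F) (analyticAlgebra U) :=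
  (MvPolynomial.eval₂Hom ((algebraMap ℝ (analyticAlgebra U)).comp (algebraMap F ℝ))
    (coord U)).toAlgebra

lemma evalAt_algebraMap (x : U) (P : MvPolynomial ι F) :
    evalAt x (algebraMap (MvPolynomial ι F) (analyticAlgebra U) P) =
      MvPolynomial.aeval x.1 P := by
  rw [RingHom.algebraMap_toAlgebra]
  induction P using MvPolynomial.induction_on with
  | C a => simp [-evalAt_apply]
  | add p q hp hq => simp only [map_add, hp, hq]
  | mul_X p i hp => simp only [map_mul, hp]; simp [coord]

lemma noZeroDivisors (hU : IsOpen U) (hc : IsPreconnected U) :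
    NoZeroDivisors (analyticAlgebra U) := by
  refine ⟨fun {a b} hab => ?_⟩
  by_contra! h
  obtain ⟨A, hA, ha⟩ := a.2
  obtain ⟨B, hB, hb⟩ := b.2
  obtain ⟨x, hx⟩ : ∃ x : U, a.1 x ≠ 0 := by
    by_contra! h'
    exact h.1 (Subtype.ext (funext h'))
  apply h.2
  have hAB : ∀ y (hy : y ∈ U), A y * B y = 0 := fun y hy => by
    rw [ha ⟨y, hy⟩, hb ⟨y, hy⟩]
    exact congrFun (congrArg Subtype.val hab) ⟨y, hy⟩
  have hev : B =ᶠ[nhds x.1] 0 := by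
    have h1 : ∀ᶠ y in nhds x.1, A y ≠ 0 :=
      (hA x.1 x.2).continuousAt.eventually_ne (by rwa [ha x])
    filter_upwards [h1, hU.mem_nhds x.2] with y h1 h2
    exact (mul_eq_zero.1 (hAB y h2)).resolve_left h1
  have := hB.eqOn_zero_of_preconnected_of_eventuallyEq_zero hc x.2 hev
  refine Subtype.ext (funext fun y => ?_)
  rw [← hb y]
  exact this y.2

lemma isDomain (hU : IsOpen U) (hc : IsPreconnected U) (x : U) :
    IsDomain (analyticAlgebra U) := by
  have := noZeroDivisors hU hc
  have : Nontrivial (analyticAlgebra U) := ⟨0, 1, fun h => zero_ne_one (congrArg (evalAt x) h)⟩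
  exact NoZeroDivisors.to_isDomain _

/-- Over a domain, an algebraic analytic function vanishing at a generic point is zero. -/
lemma eq_zero_of_generic (hU : IsOpen U) (hc : IsPreconnected U) {g : analyticAlgebra U}
    (hg : IsAlgebraic (MvPolynomial ι F) g) (x : U) (hx : AlgebraicIndependent F x.1)
    (h : g.1 x = 0) : g = 0 := by
  have := isDomain hU hc x
  by_contra hne
  obtain ⟨P, hP, q, hq⟩ := hg.exists_nonzero_dvd (mem_nonZeroDivisors_of_ne_zero hne)
  apply hP
  apply hx
  rw [map_zero, ← evalAt_algebraMap x P, hq, map_mul, evalAt_apply, h, zero_mul]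

variable {κ : Type*} [Fintype κ] {W : Set (κ → ℝ)}

/-- Pullback of analytic functions along a map of variables. -/
def pull (σ : ι → κ) (hσ : ∀ w ∈ W, w ∘ σ ∈ U) : analyticAlgebra U →+* analyticAlgebra W where
  toFun g := ⟨fun w => g.1 ⟨w.1 ∘ σ, hσ _ w.2⟩, by
    obtain ⟨G, hG, h⟩ := g.2
    refine ⟨fun w => G (w ∘ σ), fun w hw => ?_, fun w => h ⟨w.1 ∘ σ, hσ _ w.2⟩⟩
    refine AnalyticAt.fun_comp (f := fun w : κ → ℝ => w ∘ σ) (hG _ (hσ w hw)) ?_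
    exact (ContinuousLinearMap.pi fun i =>
      ContinuousLinearMap.proj (R := ℝ) (φ := fun _ : κ => ℝ) (σ i)).analyticAt w⟩
  map_one' := rfl
  map_zero' := rfl
  map_add' _ _ := rfl
  map_mul' _ _ := rfl

lemma pull_isAlgebraic (σ : ι → κ) (hinj : Function.Injective σ) (hσ : ∀ w ∈ W, w ∘ σ ∈ U)
    {g : analyticAlgebra U} (hg : IsAlgebraic (MvPolynomial ι F) g) :
    IsAlgebraic (MvPolynomial κ F) (pull σ hσ g) := by
  refine hg.ringHom_of_comp_eq (MvPolynomial.rename σ : _ →ₐ[F] MvPolynomial κ F).toRingHom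
    (pull σ hσ) (MvPolynomial.rename_injective σ hinj) ?_
  ext P w
  · change evalAt w _ = evalAt (⟨w.1 ∘ σ, hσ _ w.2⟩ : U) _
    simp only [RingHom.comp_apply, evalAt_algebraMap]
    simp
  · change evalAt w _ = evalAt (⟨w.1 ∘ σ, hσ _ w.2⟩ : U) _
    simp only [RingHom.comp_apply, evalAt_algebraMap]
    simp

end analyticAlgebra

namespace analyticAlgebra

variable {F : Type*} [Field F] [Algebra F ℝ]

/-- The entries of a family of `m`-tuples, tagged with their coordinate. -/
abbrev Entry {J : Type*} {m : ℕ} (s : J → Fin m → ℝ) : Type _ :=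
  {v : Fin m × ℝ // ∃ j, s j v.1 = v.2}

/-- A polynomial relation over `F` between the values of algebraic analytic functions at generic
points propagates to all points satisfying the same coordinate equalities. -/
lemma relation_of_generic {m n : ℕ} {J : Type*} [Finite J] {c : Fin m → ℝ} {r : ℝ} (hr : 0 < r)
    {f : Fin n → analyticAlgebra (Metric.ball c r)}
    (hf : ∀ l, IsAlgebraic (MvPolynomial (Fin m) F) (f l))
    (p : MvPolynomial (J × Fin n) F) (s : J → Fin m → ℝ) (g : Fin m → ℝ → ℝ)
    (hg : AlgebraicIndependent F
      (fun v : Entry s => g v.1.1 v.1.2))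
    (hgb : ∀ j, (fun i => g i (s j i)) ∈ Metric.ball c r)
    (h0 : MvPolynomial.aeval (fun q : J × Fin n => (f q.2).1 ⟨_, hgb q.1⟩) p = 0)
    (x : J → Fin m → ℝ) (hx : ∀ j, x j ∈ Metric.ball c r)
    (hxs : ∀ j j' i, s j i = s j' i → x j i = x j' i) :
    MvPolynomial.aeval (fun q : J × Fin n => (f q.2).1 ⟨x q.1, hx q.1⟩) p = 0 := by
  have hfin : Finite (Entry s) := by
    refine Finite.of_surjective
      (fun q : J × Fin m => (⟨(q.2, s q.1 q.2), q.1, rfl⟩ :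
        Entry s)) ?_
    rintro ⟨⟨i, v⟩, j, hj⟩
    exact ⟨(j, i), by simp only [Subtype.mk.injEq, Prod.mk.injEq, true_and]; exact hj⟩
  have := Fintype.ofFinite (Entry s)
  let d : Entry s → ℝ := fun v => c v.1.1
  let σ : J → Fin m → Entry s := fun j i => ⟨(i, s j i), j, rfl⟩
  have hσi : ∀ j, Function.Injective (σ j) := fun j i i' h =>
    congrArg (fun v : Entry s => v.1.1) h
  have hσ : ∀ j, ∀ w ∈ Metric.ball d r, w ∘ σ j ∈ Metric.ball c r := fun j w hw => by
    rw [Metric.mem_ball, dist_pi_lt_iff hr] at hw ⊢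
    exact fun i => hw (σ j i)
  let w₀ : Entry s → ℝ := fun v => g v.1.1 v.1.2
  have hw₀ : w₀ ∈ Metric.ball d r := by
    rw [Metric.mem_ball, dist_pi_lt_iff hr]
    rintro ⟨⟨i, v⟩, j, hj⟩
    have := hgb j
    rw [Metric.mem_ball, dist_pi_lt_iff hr] at this
    have := this i
    simp only at hj
    simpa [w₀, d, hj] using this
  let w₁ : Entry s → ℝ := fun v => x v.2.choose v.1.1
  have hw₁x : ∀ j, w₁ ∘ σ j = x j := fun j => funext fun i =>
    hxs _ _ _ (σ j i).2.choose_spec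
  have hw₁ : w₁ ∈ Metric.ball d r := by
    rw [Metric.mem_ball, dist_pi_lt_iff hr]
    intro v
    have := hx v.2.choose
    rw [Metric.mem_ball, dist_pi_lt_iff hr] at this
    exact this v.1.1
  have hop : IsOpen (Metric.ball d r) := Metric.isOpen_ball
  have hpc : IsPreconnected (Metric.ball d r) := (convex_ball d r).isPreconnected
  let G : analyticAlgebra (Metric.ball d r) :=
    MvPolynomial.eval₂ ((algebraMap ℝ _).comp (algebraMap F ℝ))
      (fun q : J × Fin n => pull (σ q.1) (hσ q.1) (f q.2)) p
  have hGw : ∀ w : Metric.ball d r, G.1 w =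
      MvPolynomial.aeval (fun q : J × Fin n => (f q.2).1 ⟨w.1 ∘ σ q.1, hσ q.1 w.1 w.2⟩) p := by
    intro w
    have : evalAt w G = _ := MvPolynomial.hom_eval₂ p _ (evalAt w).toRingHom _
    rw [← evalAt_apply, this, MvPolynomial.aeval_def]
    congr 1
  have hGalg : IsAlgebraic (MvPolynomial (Entry s) F) G := by
    have := isDomain hop hpc ⟨w₀, hw₀⟩
    simp only [G]
    clear h0 hGw G
    induction p using MvPolynomial.induction_on with
    | C a =>
      have : (algebraMap ℝ (analyticAlgebra (Metric.ball d r))) (algebraMap F ℝ a) =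
          algebraMap (MvPolynomial (Entry s) F) _
            (MvPolynomial.C a) := by
        rw [RingHom.algebraMap_toAlgebra]; simp
      rw [MvPolynomial.eval₂_C, RingHom.comp_apply, this]
      exact isAlgebraic_algebraMap _
    | add p q hp hq => rw [MvPolynomial.eval₂_add]; exact hp.add hq
    | mul_X p q hp =>
      rw [MvPolynomial.eval₂_mul, MvPolynomial.eval₂_X]
      exact hp.mul (pull_isAlgebraic _ (hσi _) (hσ _) (hf _))
  have hG0 : G = 0 := eq_zero_of_generic hop hpc hGalg ⟨w₀, hw₀⟩ hg (by rw [hGw]; exact h0)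
  have h1 := hGw ⟨w₁, hw₁⟩
  rw [hG0] at h1
  simp only [hw₁x] at h1
  exact h1.symm

end analyticAlgebra

section Representation

variable {F : Type*} [Field F] [Algebra F ℝ]

lemma exists_separable_root {m : ℕ} {t : Fin m → ℝ} (ht : AlgebraicIndependent F t) {a : ℝ}
    (ha : IsAlgebraic (Algebra.adjoin F (Set.range t)) a) :
    ∃ q : Polynomial (MvPolynomial (Fin m) F),
      q.eval₂ (MvPolynomial.aeval t : _ →ₐ[F] ℝ).toRingHom a = 0 ∧
      q.derivative.eval₂ (MvPolynomial.aeval t : _ →ₐ[F] ℝ).toRingHom a ≠ 0 := by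
  have : CharZero F := ((algebraMap F ℝ).charZero_iff (algebraMap F ℝ).injective).2 inferInstance
  obtain ⟨q₀, hq₀, hq₀a⟩ := ha
  suffices H : ∀ (N : ℕ) (q : Polynomial (MvPolynomial (Fin m) F)), q.natDegree = N → q ≠ 0 →
      q.eval₂ (MvPolynomial.aeval t : _ →ₐ[F] ℝ).toRingHom a = 0 →
      ∃ q : Polynomial (MvPolynomial (Fin m) F),
        q.eval₂ (MvPolynomial.aeval t : _ →ₐ[F] ℝ).toRingHom a = 0 ∧
        q.derivative.eval₂ (MvPolynomial.aeval t : _ →ₐ[F] ℝ).toRingHom a ≠ 0 by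
    refine H _ (q₀.map ht.aevalEquiv.symm.toRingEquiv.toRingHom) rfl ?_ ?_
    · rwa [Ne, Polynomial.map_eq_zero_iff]
      exact ht.aevalEquiv.symm.injective
    · rw [Polynomial.eval₂_map, ← hq₀a, Polynomial.aeval_def]
      congr 1
      ext y
      have := ht.algebraMap_aevalEquiv (ht.aevalEquiv.symm y)
      rw [AlgEquiv.apply_symm_apply] at this
      exact this.symm
  intro N
  induction N using Nat.strong_induction_on with
  | _ N ih =>
    intro q hN hq hqa
    by_cases hd : q.derivative.eval₂ (MvPolynomial.aeval t : _ →ₐ[F] ℝ).toRingHom a = 0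
    · have hdeg : q.natDegree ≠ 0 := by
        intro h0
        obtain ⟨P, rfl⟩ := Polynomial.natDegree_eq_zero.1 h0
        rw [Polynomial.eval₂_C] at hqa
        apply hq
        rw [show P = 0 from ht (by rw [map_zero]; exact hqa), map_zero]
      refine ih _ ?_ q.derivative rfl ?_ hd
      · rw [← hN]; exact Polynomial.natDegree_derivative_lt hdeg
      · exact fun h => hdeg (Polynomial.derivative_eq_zero.1 h)
    · exact ⟨q, hqa, hd⟩

open Topology ContDiff in
/-- A real algebraic over generic `t` is the value at `t` of an algebraic analytic function. -/
lemma exists_analytic_root {m : ℕ} {t : Fin m → ℝ} (ht : AlgebraicIndependent F t) {a : ℝ}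
    (ha : IsAlgebraic (Algebra.adjoin F (Set.range t)) a) :
    ∃ f : (Fin m → ℝ) → ℝ, AnalyticAt ℝ f t ∧ f t = a ∧
      ∃ q : Polynomial (MvPolynomial (Fin m) F), q ≠ 0 ∧
        ∀ᶠ x in 𝓝 t, q.eval₂ (MvPolynomial.aeval x : _ →ₐ[F] ℝ).toRingHom (f x) = 0 := by
  obtain ⟨q, hq, hq'⟩ := exists_separable_root ht ha
  let Φ : (Fin m → ℝ) × ℝ → ℝ := fun u =>
    q.eval₂ (MvPolynomial.aeval u.1 : _ →ₐ[F] ℝ).toRingHom u.2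
  have hΦ : AnalyticAt ℝ Φ (t, a) := by
    have : Φ = fun u => ∑ i ∈ Finset.range (q.natDegree + 1),
        MvPolynomial.aeval u.1 (q.coeff i) * u.2 ^ i := by
      ext u
      exact Polynomial.eval₂_eq_sum_range _ _
    rw [this]
    refine Finset.analyticAt_fun_sum _ fun i _ => AnalyticAt.mul ?_ (analyticAt_snd.pow i)
    refine AnalyticAt.aeval_mvPolynomial (fun i => ?_) _
    exact ((ContinuousLinearMap.proj (R := ℝ) (φ := fun _ : Fin m => ℝ) i).comp
      (ContinuousLinearMap.fst ℝ _ ℝ)).analyticAt _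
  have hc : ContDiffAt ℝ ω Φ (t, a) := hΦ.contDiffAt
  have hder : (fderiv ℝ Φ (t, a) ∘L .inr ℝ (Fin m → ℝ) ℝ) 1 =
      q.derivative.eval₂ (MvPolynomial.aeval t : _ →ₐ[F] ℝ).toRingHom a := by
    have h1 : HasFDerivAt Φ (fderiv ℝ Φ (t, a)) (t, a) := hΦ.differentiableAt.hasFDerivAt
    have h2 : HasFDerivAt (fun z : ℝ => Φ (t, z))
        (fderiv ℝ Φ (t, a) ∘L .inr ℝ (Fin m → ℝ) ℝ) a :=
      HasFDerivAt.comp a h1 (hasFDerivAt_prodMk_right t a)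
    have h3 := h2.hasDerivAt
    have h4 : HasDerivAt (fun z : ℝ => Φ (t, z))
        (q.derivative.eval₂ (MvPolynomial.aeval t : _ →ₐ[F] ℝ).toRingHom a) a := by
      have := (q.map (MvPolynomial.aeval t : _ →ₐ[F] ℝ).toRingHom).hasDerivAt a
      simpa only [Polynomial.derivative_map, Polynomial.eval_map] using this
    exact h3.unique h4
  have hinv : (fderiv ℝ Φ (t, a) ∘L .inr ℝ (Fin m → ℝ) ℝ).IsInvertible := by
    refine ⟨ContinuousLinearEquiv.unitsEquivAut ℝ (Units.mk0 _ hq'), ?_⟩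
    refine ContinuousLinearMap.ext_ring ?_
    rw [hder]
    simp
  have hω : (ω : ℕ∞ω) ≠ 0 := by simp
  refine ⟨hc.implicitFunction hω hinv, (hc.contDiffAt_implicitFunction hω hinv).analyticAt,
    hc.implicitFunction_apply_self hω hinv, q, ?_, ?_⟩
  · rintro rfl
    simp at hq'
  · filter_upwards [hc.eventually_apply_implicitFunction hω hinv] with x hx
    exact hx.trans hq

end Representation

section Chart

variable {F : Type*} [Field F] [Algebra F ℝ]

/-- The ball of radius `b.2` around the rational point `b.1`. -/
abbrev ratBall {m : ℕ} (b : (Fin m → ℚ) × ℚ) : Set (Fin m → ℝ) :=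
  Metric.ball (fun i => (b.1 i : ℝ)) (b.2 : ℝ)

lemma countable_algebraic_analytic [Countable F] {m : ℕ} {b : (Fin m → ℚ) × ℚ}
    (h : ∃ t : Fin m → ℝ, AlgebraicIndependent F t ∧ t ∈ ratBall b) :
    Countable {g : analyticAlgebra (ratBall b) // IsAlgebraic (MvPolynomial (Fin m) F) g} := by
  obtain ⟨t, ht, htb⟩ := h
  have := analyticAlgebra.isDomain Metric.isOpen_ball
    (convex_ball (fun i => (b.1 i : ℝ)) (b.2 : ℝ)).isPreconnected ⟨t, htb⟩
  have hinj : Function.Injective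
      (algebraMap (MvPolynomial (Fin m) F) (analyticAlgebra (ratBall b))) := by
    refine (injective_iff_map_eq_zero _).2 fun P hP => ht ?_
    rw [map_zero, ← analyticAlgebra.evalAt_algebraMap ⟨t, htb⟩ P, hP, map_zero]
  have := Module.isTorsionFree_iff_algebraMap_injective.2 hinj
  have : Countable (MvPolynomial (Fin m) F) := by
    rw [← Cardinal.mk_le_aleph0_iff]
    refine MvPolynomial.cardinalMk_le_max_lift.trans ?_
    simp
  exact (Algebraic.countable (MvPolynomial (Fin m) F) (analyticAlgebra (ratBall b))).to_subtype

variable (F) in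
/-- Tuples of `n` algebraic analytic functions on rational balls having generic points. -/
abbrev Chart (n : ℕ) : Type _ :=
  Σ m : ℕ, Σ b : {b : (Fin m → ℚ) × ℚ // ∃ t : Fin m → ℝ, AlgebraicIndependent F t ∧ t ∈ ratBall b},
    Fin n → {g : analyticAlgebra (ratBall b.1) // IsAlgebraic (MvPolynomial (Fin m) F) g}

instance [Countable F] (n : ℕ) : Countable (Chart F n) := by
  have := fun (m : ℕ) (b : {b : (Fin m → ℚ) × ℚ //
    ∃ t : Fin m → ℝ, AlgebraicIndependent F t ∧ t ∈ ratBall b}) =>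
      countable_algebraic_analytic b.2
  infer_instance

lemma evalAt_aeval {ι : Type*} [Fintype ι] {U : Set (ι → ℝ)} (x : U) (g : analyticAlgebra U)
    (q : Polynomial (MvPolynomial ι F)) :
    analyticAlgebra.evalAt x (Polynomial.aeval g q) =
      q.eval₂ (MvPolynomial.aeval x.1 : _ →ₐ[F] ℝ).toRingHom (g.1 x) := by
  have : analyticAlgebra.evalAt x (Polynomial.aeval g q) = _ :=
    Polynomial.hom_eval₂ q (algebraMap (MvPolynomial ι F) _)
      (analyticAlgebra.evalAt x).toRingHom g
  rw [this]
  congr 1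
  ext a
  · exact analyticAlgebra.evalAt_algebraMap x _
  · exact analyticAlgebra.evalAt_algebraMap x _

/-- Points algebraic over a generic tuple lie in the image of a chart. -/
lemma exists_chart {m n : ℕ} {t : Fin m → ℝ} (ht : AlgebraicIndependent F t) {a : Fin n → ℝ}
    (ha : ∀ l, IsAlgebraic (Algebra.adjoin F (Set.range t)) (a l)) :
    ∃ (b : (Fin m → ℚ) × ℚ) (hb : t ∈ ratBall b)
      (f : Fin n → {g : analyticAlgebra (ratBall b) // IsAlgebraic (MvPolynomial (Fin m) F) g}),
      (∀ i j, i ≠ j → 2 * (b.2 : ℝ) ≤ |(b.1 i : ℝ) - b.1 j|) ∧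
      ∀ l, (f l).1.1 ⟨t, hb⟩ = a l := by
  choose f hf hft q hq hqf using fun l => exists_analytic_root ht (ha l)
  have hev : ∀ᶠ x in nhds t, ∀ l, AnalyticAt ℝ (f l) x ∧
      (q l).eval₂ (MvPolynomial.aeval x : _ →ₐ[F] ℝ).toRingHom (f l x) = 0 :=
    Filter.eventually_all.2 fun l => (hf l).eventually_analyticAt.and (hqf l)
  obtain ⟨ε, hε, hball⟩ := Metric.eventually_nhds_iff_ball.1 hev
  obtain ⟨δ, hδ, hsep⟩ : ∃ δ > 0, ∀ i j, i ≠ j → δ ≤ |t i - t j| := by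
    have : ∀ᶠ δ in nhdsWithin (0 : ℝ) (Set.Ioi 0), ∀ i j, i ≠ j → δ ≤ |t i - t j| := by
      refine Filter.eventually_all.2 fun i => Filter.eventually_all.2 fun j => ?_
      by_cases hij : i = j
      · simp [hij]
      · have : 0 < |t i - t j| := abs_pos.2 (sub_ne_zero.2 (ht.injective.ne hij))
        filter_upwards [nhdsWithin_le_nhds (Iic_mem_nhds this)] with δ hδ _ using hδ
    obtain ⟨δ, h1, h2⟩ := (this.and self_mem_nhdsWithin).exists
    exact ⟨δ, h2, h1⟩
  obtain ⟨r, hr0, hr⟩ := exists_rat_btwn (show (0 : ℝ) < min ε δ / 4 by positivity)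
  have hrε : 4 * (r : ℝ) < ε := by linarith [min_le_left ε δ]
  have hrδ : 4 * (r : ℝ) < δ := by linarith [min_le_right ε δ]
  choose c hc1 hc2 using fun i => exists_rat_btwn (show t i < t i + r by linarith)
  have htb : t ∈ ratBall (c, r) := by
    rw [Metric.mem_ball, dist_pi_lt_iff hr0]
    intro i
    rw [Real.dist_eq, abs_lt]
    constructor <;> linarith [hc1 i, hc2 i]
  have hsub : ratBall (c, r) ⊆ Metric.ball t ε := fun x hx => by
    rw [Metric.mem_ball] at hx htb ⊢
    have := dist_triangle_right x t (fun i => (c i : ℝ))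
    simp only at hx htb
    linarith
  refine ⟨(c, r), htb, fun l => ⟨⟨fun x => f l x, f l, fun x hx => (hball x (hsub hx) l).1,
    fun _ => rfl⟩, q l, hq l, ?_⟩, fun i j hij => ?_, hft⟩
  · refine Subtype.ext (funext fun x => ?_)
    change analyticAlgebra.evalAt x _ = 0
    rw [evalAt_aeval]
    exact (hball x (hsub x.2) l).2
  · have h := hsep i j hij
    have h1 := abs_sub_le (t i) (c i) (t j)
    have h2 := abs_sub_le (c i : ℝ) (c j) (t j)
    have h3 : |t i - c i| < r := by rw [abs_lt]; constructor <;> linarith [hc1 i, hc2 i]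
    have h4 : |(c j : ℝ) - t j| < r := by rw [abs_lt]; constructor <;> linarith [hc1 j, hc2 j]
    simp only
    linarith

end Chart

section Injectivity

variable {F : Type*} [Field F] [Algebra F ℝ]

/-- If the value of an algebraic analytic function at a generic point does not depend on a
coordinate, then it is algebraic over the remaining coordinates. -/
lemma isAlgebraic_adjoin_of_constant {m : ℕ} {c : Fin m → ℝ} {r : ℝ}
    {f : analyticAlgebra (Metric.ball c r)} (hf : IsAlgebraic (MvPolynomial (Fin m) F) f)
    {t : Fin m → ℝ} (ht : AlgebraicIndependent F t) (htb : t ∈ Metric.ball c r) (i₀ : Fin m)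
    (h : ∀ z (hz : Function.update t i₀ z ∈ Metric.ball c r), f.1 ⟨_, hz⟩ = f.1 ⟨t, htb⟩) :
    IsAlgebraic (Algebra.adjoin F (t '' {i₀}ᶜ)) (f.1 ⟨t, htb⟩) := by
  obtain ⟨q, hq, hqf⟩ := hf
  have hlead : MvPolynomial.aeval t q.leadingCoeff ≠ 0 := fun h0 =>
    hq (Polynomial.leadingCoeff_eq_zero.1 (ht (by rw [h0, map_zero])))
  have hcont : Continuous (fun z : ℝ => Function.update t i₀ z) := by fun_prop
  have hcont' : Continuous (fun z : ℝ =>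
      MvPolynomial.aeval (Function.update t i₀ z) q.leadingCoeff) := by
    have : Continuous fun x : Fin m → ℝ => MvPolynomial.aeval x q.leadingCoeff := by
      rw [continuous_iff_continuousAt]
      exact fun x => (AnalyticAt.aeval_mvPolynomial (𝕜 := ℝ) (f := fun x : Fin m → ℝ => x)
        (fun i => (ContinuousLinearMap.proj (R := ℝ) (φ := fun _ : Fin m => ℝ) i).analyticAt x)
        _).continuousAt
    exact this.comp hcont
  have hopen : IsOpen {z : ℝ | Function.update t i₀ z ∈ Metric.ball c r ∧
      MvPolynomial.aeval (Function.update t i₀ z) q.leadingCoeff ≠ 0} :=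
    (Metric.isOpen_ball.preimage hcont).inter (isOpen_ne.preimage hcont')
  obtain ⟨z, ⟨hzb, hzl⟩⟩ := (Rat.denseRange_cast (𝕜 := ℝ)).exists_mem_open hopen
    ⟨t i₀, by simpa using ⟨htb, hlead⟩⟩
  have : CharZero F := ((algebraMap F ℝ).charZero_iff (algebraMap F ℝ).injective).2 inferInstance
  have hmem : ∀ i, Function.update t i₀ (z : ℝ) i ∈ Algebra.adjoin F (t '' {i₀}ᶜ) := fun i => by
    by_cases hi : i = i₀
    · subst hi
      rw [Function.update_self, ← map_ratCast (algebraMap F ℝ) z]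
      exact Subalgebra.algebraMap_mem _ _
    · rw [Function.update_of_ne hi]
      exact Algebra.subset_adjoin ⟨i, hi, rfl⟩
  let ψ : MvPolynomial (Fin m) F →ₐ[F] Algebra.adjoin F (t '' {i₀}ᶜ) :=
    MvPolynomial.aeval fun i => ⟨_, hmem i⟩
  have hψ : ∀ P, (ψ P : ℝ) = MvPolynomial.aeval (Function.update t i₀ (z : ℝ)) P := fun P => by
    have : (Algebra.adjoin F (t '' {i₀}ᶜ)).val.comp ψ =
        MvPolynomial.aeval (Function.update t i₀ (z : ℝ)) := by
      ext i
      simp [ψ]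
    exact DFunLike.congr_fun this P
  refine ⟨q.map ψ.toRingHom, fun h0 => hzl ?_, ?_⟩
  · rw [← hψ]
    have := congrArg (fun Q => Q.coeff q.natDegree) h0
    simp only [Polynomial.coeff_map, Polynomial.coeff_zero] at this
    exact congrArg Subtype.val this
  · rw [Polynomial.aeval_def, Polynomial.eval₂_map, ← h z hzb]
    have := congrArg (analyticAlgebra.evalAt ⟨_, hzb⟩) hqf
    rw [evalAt_aeval, map_zero] at this
    rw [← this]
    congr 1
    ext P
    · exact hψ _
    · exact hψ _

/-- A chart through a point with no redundant coordinate is injective on generic points. -/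
lemma chart_injective {m n : ℕ} {c : Fin m → ℝ} {r : ℝ} (hr : 0 < r)
    {f : Fin n → analyticAlgebra (Metric.ball c r)}
    (hf : ∀ l, IsAlgebraic (MvPolynomial (Fin m) F) (f l))
    {t : Fin m → ℝ} (ht : AlgebraicIndependent F t) (htb : t ∈ Metric.ball c r)
    (hmin : ∀ i₀, ∃ l, ¬ IsAlgebraic (Algebra.adjoin F (t '' {i₀}ᶜ)) ((f l).1 ⟨t, htb⟩))
    {g : Fin m → ℝ → ℝ} (hg : AlgebraicIndependent F (fun v : Fin m × ℝ => g v.1 v.2))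
    (hgb : ∀ y : Fin m → ℝ, (fun i => g i (y i)) ∈ Metric.ball c r) :
    Function.Injective (fun (y : Fin m → ℝ) l => (f l).1 ⟨_, hgb y⟩) := by
  intro y y' hyy
  by_contra hne
  obtain ⟨i₀, hi₀⟩ := Function.ne_iff.1 hne
  obtain ⟨l, hl⟩ := hmin i₀
  refine hl (isAlgebraic_adjoin_of_constant (hf l) ht htb i₀ fun z hz => ?_)
  let s : Bool → Fin m → ℝ := fun j => cond j y y'
  have key := analyticAlgebra.relation_of_generic hr hf
    (MvPolynomial.X (false, l) - MvPolynomial.X (true, l)) s g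
    (hg.comp Subtype.val Subtype.val_injective) (fun j => hgb (s j))
    (by
      rw [map_sub, MvPolynomial.aeval_X, MvPolynomial.aeval_X, sub_eq_zero]
      exact (congrFun hyy l).symm)
    (fun j => cond j t (Function.update t i₀ z))
    (by rintro (_ | _) <;> assumption)
    (by
      rintro (_ | _) (_ | _) i h
      · rfl
      · have : i ≠ i₀ := by rintro rfl; exact hi₀ h.symm
        simp [this]
      · have : i ≠ i₀ := by rintro rfl; exact hi₀ h
        simp [this]
      · rfl)
  rw [map_sub, MvPolynomial.aeval_X, MvPolynomial.aeval_X, sub_eq_zero] at key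
  exact key

end Injectivity

section Basis

variable {F : Type} [Field F] [Algebra F ℝ]

lemma AlgebraicIndependent.add_ratCast {ι : Type*} {x : ι → ℝ} (hx : AlgebraicIndependent F x)
    (ρ : ι → ℚ) : AlgebraicIndependent F fun i => x i + ρ i := by
  have : CharZero F := ((algebraMap F ℝ).charZero_iff (algebraMap F ℝ).injective).2 inferInstance
  let φ : MvPolynomial ι F →ₐ[F] MvPolynomial ι F :=
    MvPolynomial.aeval fun i => MvPolynomial.X i + MvPolynomial.C (ρ i : F)
  let ψ : MvPolynomial ι F →ₐ[F] MvPolynomial ι F :=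
    MvPolynomial.aeval fun i => MvPolynomial.X i - MvPolynomial.C (ρ i : F)
  have h1 : ψ.comp φ = AlgHom.id F _ := by
    ext i : 1
    simp [φ, ψ, MvPolynomial.algHom_C]
  have h2 : (MvPolynomial.aeval fun i => x i + ρ i : MvPolynomial ι F →ₐ[F] ℝ) =
      (MvPolynomial.aeval x).comp φ := by
    ext i
    simp [φ]
  change Function.Injective (MvPolynomial.aeval fun i => x i + (ρ i : ℝ) : MvPolynomial ι F →ₐ[F] ℝ)
  rw [h2]
  have : Function.Injective φ := Function.LeftInverse.injective (g := ψ) fun p =>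
    DFunLike.congr_fun h1 p
  rw [AlgHom.coe_comp]
  exact Function.Injective.comp (show Function.Injective (MvPolynomial.aeval x) from hx) this

lemma exists_generic_in_ball {τ : ℝ → ℝ} (hτ : AlgebraicIndependent F τ) {m : ℕ}
    (c : Fin m → ℝ) {r : ℝ} (hr : 0 < r) :
    ∃ g : Fin m → ℝ → ℝ, AlgebraicIndependent F (fun v : Fin m × ℝ => g v.1 v.2) ∧
      ∀ y : Fin m → ℝ, (fun i => g i (y i)) ∈ Metric.ball c r := by
  have hcard : #(Fin m × ℝ) ≤ #ℝ := by
    rw [Cardinal.mk_prod, Cardinal.lift_id, Cardinal.lift_id]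
    exact (mul_le_mul' Cardinal.mk_le_aleph0 le_rfl).trans
      (Cardinal.aleph0_mul_eq (Cardinal.aleph0_le_mk ℝ)).le
  obtain ⟨e⟩ := hcard
  choose ρ hρ1 hρ2 using fun v : Fin m × ℝ =>
    exists_rat_btwn (show c v.1 - r - τ (e v) < c v.1 + r - τ (e v) by linarith)
  refine ⟨fun i v => τ (e (i, v)) + ρ (i, v), (hτ.comp e e.injective).add_ratCast ρ, fun y => ?_⟩
  rw [Metric.mem_ball, dist_pi_lt_iff hr]
  intro i
  rw [Real.dist_eq, abs_lt]
  constructor <;> linarith [hρ1 (i, y i), hρ2 (i, y i)]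

variable (F) in
lemma exists_real_indexed_transcendence_basis [Countable F] :
    ∃ τ : ℝ → ℝ, IsTranscendenceBasis F τ := by
  obtain ⟨ι, x, hx⟩ := exists_isTranscendenceBasis' F ℝ
  have hle : #ι ≤ #ℝ := Cardinal.mk_le_of_injective hx.1.injective
  have halg := hx.isAlgebraic
  have h1 : #ℝ ≤ max #F (max #ι ℵ₀) := by
    refine (Algebra.IsAlgebraic.cardinalMk_le_max (Algebra.adjoin F (Set.range x)) ℝ).trans ?_
    rw [← Cardinal.mk_congr hx.1.aevalEquiv.toEquiv]
    refine (max_le_max_right _ MvPolynomial.cardinalMk_le_max).trans (le_of_eq ?_)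
    rw [max_assoc, max_self, max_assoc]
  have hunc : ℵ₀ < #ℝ := by rw [Cardinal.mk_real]; exact Cardinal.aleph0_lt_continuum
  have hge : #ℝ ≤ #ι := by
    by_contra! hlt
    exact absurd h1 (not_le.2 (max_lt ((Cardinal.mk_le_aleph0).trans_lt hunc) (max_lt hlt hunc)))
  obtain ⟨e⟩ := Cardinal.eq.1 (le_antisymm hge hle)
  exact ⟨x ∘ e, hx.comp_equiv e⟩

lemma exists_minimal_support {τ : ℝ → ℝ} (hτ : IsTranscendenceBasis F τ) {n : ℕ} (a : Fin n → ℝ) :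
    ∃ (m : ℕ) (s : Fin m → ℝ), Function.Injective s ∧
      (∀ l, IsAlgebraic (Algebra.adjoin F (Set.range (τ ∘ s))) (a l)) ∧
      ∀ i₀, ∃ l, ¬ IsAlgebraic (Algebra.adjoin F ((τ ∘ s) '' {i₀}ᶜ)) (a l) := by
  have halg := hτ.isAlgebraic
  have hcl : ∀ (T : Set ℝ) (z : ℝ), z ∈ (AlgebraicIndependent.matroid F ℝ).closure T ↔
      IsAlgebraic (Algebra.adjoin F T) z := fun T z => by
    rw [AlgebraicIndependent.matroid_closure_eq]
    exact SetLike.mem_coe.trans (Subalgebra.mem_algebraicClosure _ _)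
  obtain ⟨I, hIτ, hIfin, -, hI⟩ :=
    (AlgebraicIndependent.matroid F ℝ).exists_subset_finite_closure_of_subset_closure
      (X := Set.range a) (Y := Set.range τ) (Set.finite_range a)
      fun z _ => (hcl _ z).2 (halg.isAlgebraic z)
  obtain ⟨S₀, hS₀⟩ : ∃ S : Finset ℝ, τ '' S = I :=
    ⟨(hIfin.preimage hτ.1.injective.injOn).toFinset, by
      rw [Set.Finite.coe_toFinset, Set.image_preimage_eq_of_subset hIτ]⟩
  obtain ⟨S, hS⟩ := exists_minimal_of_wellFoundedLT
    (fun S : Finset ℝ => ∀ l, IsAlgebraic (Algebra.adjoin F (τ '' S)) (a l))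
    ⟨S₀, fun l => (hcl _ _).1 (hS₀ ▸ hI ⟨l, rfl⟩)⟩
  let e := S.equivFin
  let s : Fin S.card → ℝ := fun i => (e.symm i : ℝ)
  have hs : Function.Injective s := Subtype.val_injective.comp e.symm.injective
  have hsr : Set.range s = S := by
    ext z
    exact ⟨by rintro ⟨i, rfl⟩; exact (e.symm i).2, fun h => ⟨e ⟨z, h⟩, by simp [s]⟩⟩
  refine ⟨S.card, s, hs, fun l => ?_, fun i₀ => ?_⟩
  · rw [Set.range_comp, hsr]
    exact hS.prop l
  · by_contra! hcon
    have hsub : (τ ∘ s) '' {i₀}ᶜ = τ '' (S.erase (s i₀) : Finset ℝ) := by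
      rw [Set.image_comp, Set.image_compl_eq_range_sdiff_image hs, hsr]
      simp
    rw [hsub] at hcon
    have := hS.le_of_le hcon (Finset.erase_subset _ _)
    exact Finset.notMem_erase (s i₀) S (this (e.symm i₀).2)

end Basis

section Coloring

variable {V : Type} {E : Set (Set V)} {κ : Cardinal}

lemma HGColorable.mono {κ' : Cardinal} (h : HGColorable E κ) (hκ : κ ≤ κ') : HGColorable E κ' := by
  obtain ⟨α, φ, hα, hφ⟩ := h
  exact ⟨α, φ, hα.trans hκ, hφ⟩

lemma chrNum_le_iff (hE : ∀ e ∈ E, e.Nontrivial) : chrNum E ≤ κ ↔ HGColorable E κ := by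
  refine ⟨fun h => ?_, fun h => csInf_le' h⟩
  have hne : {κ | HGColorable E κ}.Nonempty := ⟨#V, V, id, le_rfl, hE⟩
  have : HGColorable E (chrNum E) := csInf_mem hne
  exact this.mono h

lemma HGColorable.comap {W : Type} {E' : Set (Set W)} (h : HGColorable E κ)
    (hc : HGContains E' E) : HGColorable E' κ := by
  obtain ⟨α, φ, hα, hφ⟩ := h
  obtain ⟨f, -, hf⟩ := hc
  refine ⟨α, φ ∘ f, hα, fun e he => ?_⟩
  obtain ⟨_, ⟨x, hx, rfl⟩, _, ⟨y, hy, rfl⟩, hxy⟩ := hφ _ (hf e he)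
  exact ⟨x, hx, y, hy, hxy⟩

lemma HGColorable.exists_coloring_out (h : HGColorable E κ) :
    ∃ φ : V → κ.out, ∀ e ∈ E, ∃ x ∈ e, ∃ y ∈ e, φ x ≠ φ y := by
  obtain ⟨α, φ, hα, hφ⟩ := h
  rw [← Cardinal.mk_out κ] at hα
  obtain ⟨ι⟩ := hα
  refine ⟨ι ∘ φ, fun e he => ?_⟩
  obtain ⟨x, hx, y, hy, hxy⟩ := hφ e he
  exact ⟨x, hx, y, hy, ι.injective.ne hxy⟩

/-- Colorings of countably many vertex classes combine to a coloring. -/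
lemma HGColorable.of_countable_classes (hκ : ℵ₀ ≤ κ) (hE : ∀ e ∈ E, e.Nonempty) {C : Type}
    [Countable C] (code : V → C)
    (h : ∀ c, HGColorable {e ∈ E | ∀ x ∈ e, code x = c} κ) : HGColorable E κ := by
  choose φ hφ using fun c => (h c).exists_coloring_out
  refine ⟨C × κ.out, fun v => (code v, φ (code v) v), ?_, fun e he => ?_⟩
  · rw [Cardinal.mk_prod, Cardinal.lift_id, Cardinal.lift_id, Cardinal.mk_out]
    exact (mul_le_mul' Cardinal.mk_le_aleph0 le_rfl).trans (Cardinal.aleph0_mul_eq hκ).le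
  · by_contra! hcon
    obtain ⟨x₀, hx₀⟩ := hE e he
    have hcode : ∀ x ∈ e, code x = code x₀ := fun x hx => congrArg Prod.fst (hcon x hx x₀ hx₀)
    obtain ⟨x, hx, y, hy, hxy⟩ := hφ (code x₀) e ⟨he, hcode⟩
    refine hxy ?_
    have := congrArg Prod.snd (hcon x hx y hy)
    simpa only [hcode x hx, hcode y hy] using this

lemma range_mem_templateEdges {k m : ℕ} {s s' : Fin k → Fin m → ℝ} (hs : Function.Injective s)
    (hs' : Function.Injective s') (h : ∀ i j j', s' j i = s' j' i → s j i = s j' i) :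
    Set.range s ∈ templateEdges k (B := fun _ : Fin m => ℝ) (Set.range s') := by
  refine ⟨?_, Function.extend s' s 0, ?_, ?_, ?_⟩
  · rw [← Set.image_univ, Set.ncard_image_of_injective _ hs, Set.ncard_univ, Nat.card_fin]
  · rintro _ ⟨j, rfl⟩
    rw [hs'.extend_apply]
    exact ⟨j, rfl⟩
  · rintro _ ⟨j, rfl⟩
    exact ⟨s' j, ⟨j, rfl⟩, hs'.extend_apply s 0 j⟩
  · rintro _ ⟨j, rfl⟩ _ ⟨j', rfl⟩ i hi
    rw [hs'.extend_apply, hs'.extend_apply]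
    exact h i j j' hi

/-- A single coloring that is proper for every edge whose own template hypergraph is colorable. -/
lemma exists_uniform_coloring (hκ : ℵ₀ ≤ κ) (k m : ℕ) :
    HGColorable {A : Set (Fin m → ℝ) | ∃ s : Fin k → Fin m → ℝ, Function.Injective s ∧
      HGColorable (templateEdges k (B := fun _ : Fin m => ℝ) (Set.range s)) κ ∧
      A = Set.range s} κ := by
  have key : ∀ e : Fin m → Fin k → Fin k → Prop, ∃ φ : (Fin m → ℝ) → κ.out,
      ∀ s : Fin k → Fin m → ℝ, Function.Injective s → (∀ i j j', e i j j' ↔ s j i = s j' i) →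
        HGColorable (templateEdges k (B := fun _ : Fin m => ℝ) (Set.range s)) κ →
        ∃ x ∈ Set.range s, ∃ y ∈ Set.range s, φ x ≠ φ y := by
    intro e
    by_cases he : ∃ s : Fin k → Fin m → ℝ, Function.Injective s ∧
        (∀ i j j', e i j j' ↔ s j i = s j' i) ∧
        HGColorable (templateEdges k (B := fun _ : Fin m => ℝ) (Set.range s)) κ
    · obtain ⟨s', hs', hes', hcol⟩ := he
      obtain ⟨φ, hφ⟩ := hcol.exists_coloring_out
      exact ⟨φ, fun s hs hes _ => hφ _ (range_mem_templateEdges hs hs' fun i j j' hj =>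
        (hes i j j').1 ((hes' i j j').2 hj))⟩
    · have : Nonempty κ.out := by
        rw [← Cardinal.mk_ne_zero_iff, Cardinal.mk_out]
        exact (Cardinal.aleph0_pos.trans_le hκ).ne'
      exact ⟨fun _ => Classical.arbitrary _, fun s hs hes hcol => (he ⟨s, hs, hes, hcol⟩).elim⟩
  choose φ hφ using key
  refine ⟨(Fin m → Fin k → Fin k → Prop) → κ.out, fun x e => φ e x, ?_, ?_⟩
  · rw [← Cardinal.power_def, Cardinal.mk_out, ← Nat.cast_card]
    exact Cardinal.power_nat_le hκ
  · rintro _ ⟨s, hs, hcol, rfl⟩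
    obtain ⟨x, hx, y, hy, hxy⟩ := hφ (fun i j j' => s j i = s j' i) s hs (fun _ _ _ => Iff.rfl) hcol
    exact ⟨x, hx, y, hy, fun h => hxy (congrFun h _)⟩

end Coloring

section Representation

variable {F : Type} [Field F] [Algebra F ℝ] {n : ℕ} {τ : ℝ → ℝ}

/-- The point `a` is the image under the chart `c` of the generic tuple `τ ∘ s`, all of whose
entries are needed to generate `a` up to algebraic closure. -/
def Represents (τ : ℝ → ℝ) (c : Chart F n) (s : Fin c.1 → ℝ) (a : Fin n → ℝ) : Prop :=
  Function.Injective s ∧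
    (∀ i j, i ≠ j → 2 * (c.2.1.1.2 : ℝ) ≤ |(c.2.1.1.1 i : ℝ) - c.2.1.1.1 j|) ∧
    (∀ i₀, ∃ l, ¬ IsAlgebraic (Algebra.adjoin F ((τ ∘ s) '' {i₀}ᶜ)) (a l)) ∧
    ∃ hb : τ ∘ s ∈ ratBall c.2.1.1, ∀ l, (c.2.2 l).1.1 ⟨τ ∘ s, hb⟩ = a l

lemma exists_represents (hτ : IsTranscendenceBasis F τ) (a : Fin n → ℝ) :
    ∃ (c : Chart F n) (s : Fin c.1 → ℝ), Represents τ c s a := by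
  obtain ⟨m, s, hs, ha, hmin⟩ := exists_minimal_support hτ a
  obtain ⟨b, hb, f, hsep, hf⟩ := exists_chart (hτ.1.comp s hs) ha
  exact ⟨⟨m, ⟨b, τ ∘ s, hτ.1.comp s hs, hb⟩, f⟩, s, hs, hsep, hmin, hb, hf⟩

lemma Represents.unique {c : Chart F n} {s : Fin c.1 → ℝ} {a a' : Fin n → ℝ}
    (h : Represents τ c s a) (h' : Represents τ c s a') : a = a' := by
  obtain ⟨-, -, -, hb, hf⟩ := h
  obtain ⟨-, -, -, hb', hf'⟩ := h'
  exact funext fun l => (hf l).symm.trans (hf' l)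

lemma Represents.injective {c : Chart F n} {k : ℕ} {s : Fin k → Fin c.1 → ℝ}
    {a : Fin k → Fin n → ℝ} (h : ∀ j, Represents τ c (s j) (a j)) (ha : Function.Injective a) :
    Function.Injective s := fun j j' hj => ha ((h j).unique (hj ▸ h j'))

lemma Represents.dim_pos {c : Chart F n} {k : ℕ} (hk : 2 ≤ k) {s : Fin k → Fin c.1 → ℝ}
    {a : Fin k → Fin n → ℝ} (h : ∀ j, Represents τ c (s j) (a j)) (ha : Function.Injective a) :
    1 ≤ c.1 := by
  by_contra! hm
  have : IsEmpty (Fin c.1) := by rw [Nat.lt_one_iff.1 hm]; infer_instance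
  have := Represents.injective h ha (Subsingleton.elim (s ⟨0, by omega⟩) (s ⟨1, by omega⟩))
  simp at this

/-- An algebraic hypergraph containing an edge represented by a single chart contains the
template hypergraph of the representing tuples. -/
lemma Represents.contains (hτ : AlgebraicIndependent F τ) {c : Chart F n} {k : ℕ} (hk : 0 < k)
    {s : Fin k → Fin c.1 → ℝ} {a : Fin k → Fin n → ℝ} (h : ∀ j, Represents τ c (s j) (a j))
    (p : MvPolynomial (Fin k × Fin n) F) (hp : MvPolynomial.aeval (fun q => a q.1 q.2) p = 0) :
    HGContains (templateEdges k (B := fun _ : Fin c.1 => ℝ) (Set.range s))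
      (zeroEdges (p.map (algebraMap F ℝ))) := by
  obtain ⟨m, ⟨b, hbt⟩, f⟩ := c
  choose hinj hsep hmin hball hfa using h
  dsimp only at s hinj hsep hmin hball hfa ⊢
  have hr : 0 < (b.2 : ℝ) := Metric.nonempty_ball.1 ⟨_, hball ⟨0, hk⟩⟩
  obtain ⟨g, hg, hgb⟩ := exists_generic_in_ball hτ (fun i => (b.1 i : ℝ)) hr
  have hΨ := chart_injective hr (fun l => (f l).2) (hτ.comp _ (hinj ⟨0, hk⟩)) (hball ⟨0, hk⟩)
    (fun i₀ => by simpa only [hfa] using hmin ⟨0, hk⟩ i₀) hg hgb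
  refine ⟨_, hΨ, ?_⟩
  rintro Q ⟨hQ, φ, hφ1, hφ2, hφ3⟩
  have hQr : Set.range (fun j => φ (s j)) = Q := by
    rw [← hφ2.image_eq_of_mapsTo hφ1, ← Set.range_comp]
    rfl
  have hφinj : Function.Injective fun j => φ (s j) := by
    rw [← Set.injOn_univ]
    refine Set.injOn_of_ncard_image_eq ?_
    rw [Set.image_univ, hQr, hQ, Set.ncard_univ, Nat.card_fin]
  refine ⟨fun j l => (f l).1.1 ⟨_, hgb (φ (s j))⟩, hΨ.comp hφinj, ?_, ?_⟩
  · rw [← hQr, ← Set.range_comp]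
    rfl
  · have hent : Function.Injective fun v : analyticAlgebra.Entry s => v.1.2 := by
      rintro ⟨⟨i, z⟩, j, hj⟩ ⟨⟨i', z'⟩, j', hj'⟩ (rfl : z = z')
      dsimp only at hj hj'
      have : i = i' := by
        by_contra hne
        have h1 := (dist_pi_lt_iff hr).1 (hball j) i
        have h2 := (dist_pi_lt_iff hr).1 (hball j') i'
        have h3 := hsep ⟨0, hk⟩ i i' hne
        rw [Function.comp_apply, hj, dist_comm] at h1
        rw [Function.comp_apply, hj'] at h2
        have h4 := dist_triangle (b.1 i : ℝ) (τ z) (b.1 i')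
        rw [Real.dist_eq (b.1 i : ℝ) (b.1 i')] at h4
        linarith
      subst this
      rfl
    have hp' : MvPolynomial.aeval (fun q : Fin k × Fin n =>
        (f q.2).1.1 ⟨τ ∘ s q.1, hball q.1⟩) p = 0 := by
      simpa only [hfa] using hp
    have := analyticAlgebra.relation_of_generic hr (fun l => (f l).2) p s (fun _ => τ)
      (hτ.comp _ hent) hball hp'
      (fun j i => g i (φ (s j) i)) (fun j => hgb _) fun j j' i hi => by
        rw [hφ3 _ ⟨j, rfl⟩ _ ⟨j', rfl⟩ i hi]
    rw [MvPolynomial.eval_map, ← MvPolynomial.aeval_def]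
    exact this

end Representation

lemma exists_countable_field_map_eq {σ : Type} (p : MvPolynomial σ ℝ) :
    ∃ F : Subfield ℝ, Countable F ∧ ∃ q : MvPolynomial σ F, q.map (algebraMap F ℝ) = p := by
  refine ⟨Subfield.closure (p.coeffs : Set ℝ), ?_, ?_⟩
  · rw [← Cardinal.mk_le_aleph0_iff]
    exact (Subfield.cardinalMk_closure_le_max _).trans (max_le Cardinal.mk_le_aleph0 le_rfl)
  · refine MvPolynomial.mem_range_map_iff_coeffs_subset.2 fun x hx => ?_
    exact ⟨⟨x, Subfield.subset_closure hx⟩, rfl⟩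

lemma nontrivial_of_mem_templateEdges {k m : ℕ} (hk : 2 ≤ k) {P Q : Set (Fin m → ℝ)}
    (hQ : Q ∈ templateEdges k (B := fun _ : Fin m => ℝ) P) : Q.Nontrivial := by
  exact (Set.one_lt_ncard_iff_nontrivial_and_finite.1 (hk.trans_eq hQ.1.symm)).1

lemma nontrivial_of_mem_zeroEdges {k n : ℕ} (hk : 2 ≤ k) {p : MvPolynomial (Fin k × Fin n) ℝ}
    {A : Set (Fin n → ℝ)} (hA : A ∈ zeroEdges p) : A.Nontrivial := by
  obtain ⟨a, ha, rfl, -⟩ := hA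
  exact ⟨_, ⟨⟨0, by omega⟩, rfl⟩, _, ⟨⟨1, by omega⟩, rfl⟩, ha.ne (by simp)⟩

/-- Theorem 2.2, (1) ⟺ (2): for an algebraic `k`-hypergraph
`H` on `ℝⁿ` and infinite `κ`, `χ(H) ≤ κ` iff every template hypergraph
`L(ℝ^d, P)` contained in `H` satisfies `χ(L(ℝ^d, P)) ≤ κ`. -/
theorem statement1 (n k : ℕ) (hn : 1 ≤ n) (hk : 2 ≤ k)
    (E : Set (Set (Fin n → ℝ)))
    (hE : ∃ p : MvPolynomial (Fin k × Fin n) ℝ, E = zeroEdges p)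
    (κ : Cardinal) (hκ : Cardinal.aleph0 ≤ κ) :
    chrNum E ≤ κ ↔
      ∀ d : ℕ, 1 ≤ d → ∀ P : Set (Fin d → ℝ), P.ncard = k →
        HGContains (templateEdges k (B := fun _ : Fin d => ℝ) P) E →
        chrNum (templateEdges k (B := fun _ : Fin d => ℝ) P) ≤ κ := by
  obtain ⟨p, rfl⟩ := hE
  rw [chrNum_le_iff fun A => nontrivial_of_mem_zeroEdges hk]
  refine ⟨fun h d _ P _ hP => csInf_le' (h.comap hP), fun h => ?_⟩
  obtain ⟨F, hF, p, rfl⟩ := exists_countable_field_map_eq p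
  obtain ⟨τ, hτ⟩ := exists_real_indexed_transcendence_basis F
  choose code s hs using fun a : Fin n → ℝ => exists_represents hτ a
  refine HGColorable.of_countable_classes hκ
    (fun A hA => (nontrivial_of_mem_zeroEdges hk hA).nonempty) code fun c => ?_
  obtain ⟨α, φ, hα, hφ⟩ := exists_uniform_coloring hκ k c.1
  have hs' : ∀ a, ∃ t : Fin c.1 → ℝ, code a = c → Represents τ c t a := fun a => by
    by_cases hc : code a = c
    · exact hc ▸ ⟨s a, fun _ => hs a⟩
    · exact ⟨0, fun h => (hc h).elim⟩
  choose t ht using hs'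
  refine ⟨α, φ ∘ t, hα, ?_⟩
  rintro _ ⟨⟨a, ha, rfl, hpa⟩, hc⟩
  have hrep : ∀ j, Represents τ c (t (a j)) (a j) := fun j => ht _ (hc _ ⟨j, rfl⟩)
  rw [MvPolynomial.eval_map, ← MvPolynomial.aeval_def] at hpa
  have hinj := Represents.injective hrep ha
  have hcol : chrNum (templateEdges k (B := fun _ : Fin c.1 => ℝ)
      (Set.range fun j => t (a j))) ≤ κ := by
    refine h c.1 (Represents.dim_pos hk hrep ha) _ ?_
      (Represents.contains hτ.1 (by omega) hrep p hpa)
    rw [← Set.image_univ, Set.ncard_image_of_injective _ hinj, Set.ncard_univ, Nat.card_fin]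
  rw [chrNum_le_iff fun A => nontrivial_of_mem_templateEdges hk] at hcol
  obtain ⟨_, ⟨j, rfl⟩, _, ⟨j', rfl⟩, hjj'⟩ := hφ _ ⟨_, hinj, hcol, rfl⟩
  exact ⟨_, ⟨j, rfl⟩, _, ⟨j', rfl⟩, hjj'⟩
end
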